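/- arXiv:2304.06128 — 5 statements merged into one kernel-verified Lean document; each statement's English description precedes it below -/
import Mathlib

section
/- Let X and Y be independent nonnegative real random variables with E[log₂(1 + X)] < ∞, and let T > 0. Then E[ max( T·log₂(1+X) − T·log₂(1+Y), 0 ) ] = (T / ln 2) · ∫₀^∞ P(X > x) · P(Y ≤ x) / (1 + x) dx. -/
open MeasureTheory ProbabilityTheory Real

theorem lintegral_Ico_ofReal_inv_one_add {a b : ℝ} (ha : 0 ≤ a) (hb : 0 ≤ b) :
    ∫⁻ x in Set.Ico b a, ENNReal.ofReal (1 + x)⁻¹ =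
      ENNReal.ofReal (max (log (1 + a) - log (1 + b)) 0) := by
  rcases le_total a b with hab | hab
  · have hlog : log (1 + a) ≤ log (1 + b) := log_le_log (by linarith) (by linarith)
    rw [Set.Ico_eq_empty (not_lt.mpr hab), max_eq_right (by linarith)]
    simp
  · have hlog : log (1 + b) ≤ log (1 + a) := log_le_log (by linarith) (by linarith)
    have hcont : ContinuousOn (fun x : ℝ => (1 + x)⁻¹) (Set.Icc b a) :=
      ContinuousOn.inv₀ (by fun_prop) fun x hx => by linarith [hx.1]
    have hint : IntervalIntegrable (fun x : ℝ => (1 + x)⁻¹) volume b a :=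
      ContinuousOn.intervalIntegrable (by rwa [Set.uIcc_of_le hab])
    have hFTC : ∫ x in b..a, (1 + x)⁻¹ = log (1 + a) - log (1 + b) := by
      refine intervalIntegral.integral_eq_sub_of_hasDerivAt
        (f := fun x => log (1 + x)) (fun x hx => ?_) hint
      rw [Set.uIcc_of_le hab] at hx
      have hx0 : 1 + x ≠ 0 := by linarith [hx.1]
      simpa using ((hasDerivAt_id x).const_add 1).log hx0
    rw [max_eq_left (by linarith), ← hFTC, intervalIntegral.integral_of_le hab,
      setLIntegral_congr Ico_ae_eq_Ioc,
      ofReal_integral_eq_lintegral_ofReal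
        ((intervalIntegrable_iff_integrableOn_Ioc_of_le hab).mp hint)]
    filter_upwards [ae_restrict_mem measurableSet_Ioc] with x hx
    exact inv_nonneg.mpr (by linarith [hx.1])

/-- Layer-cake formula for the positive part of `log (1 + X) - log (1 + Y)`. -/
theorem ProbabilityTheory.IndepFun.lintegral_log_one_add_sub_log_one_add
    {Ω : Type*} [MeasurableSpace Ω] {μ : Measure Ω} [SFinite μ] {X Y : Ω → ℝ}
    (hind : IndepFun X Y μ) (hmX : Measurable X) (hmY : Measurable Y)
    (hX0 : ∀ ω, 0 ≤ X ω) (hY0 : ∀ ω, 0 ≤ Y ω) :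
    ∫⁻ ω, ENNReal.ofReal (max (log (1 + X ω) - log (1 + Y ω)) 0) ∂μ =
      ∫⁻ x in Set.Ioi (0 : ℝ),
        μ {ω | x < X ω} * μ {ω | Y ω ≤ x} * ENNReal.ofReal (1 + x)⁻¹ := by
  let S : Set (Ω × ℝ) := {p | Y p.1 ≤ p.2 ∧ p.2 < X p.1}
  have hS : MeasurableSet S :=
    (measurableSet_le (hmY.comp measurable_fst) measurable_snd).inter
      (measurableSet_lt measurable_snd (hmX.comp measurable_fst))
  let g : Ω × ℝ → ENNReal := S.indicator fun p => ENNReal.ofReal (1 + p.2)⁻¹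
  have hg : Measurable g := Measurable.indicator (by fun_prop) hS
  calc
    _ = ∫⁻ ω, (∫⁻ x in Set.Ioi (0 : ℝ), g (ω, x)) ∂μ := by
      refine lintegral_congr fun ω => ?_
      have hslice : (fun x => g (ω, x)) =
          (Set.Ico (Y ω) (X ω)).indicator fun x => ENNReal.ofReal (1 + x)⁻¹ := rfl
      rw [hslice, setLIntegral_congr Ioi_ae_eq_Ici, lintegral_indicator measurableSet_Ico,
        Measure.restrict_restrict measurableSet_Ico,
        Set.inter_eq_left.mpr (Set.Ico_subset_Ici_self.trans (Set.Ici_subset_Ici.mpr (hY0 ω))),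
        lintegral_Ico_ofReal_inv_one_add (hX0 ω) (hY0 ω)]
    _ = ∫⁻ x in Set.Ioi (0 : ℝ), ∫⁻ ω, g (ω, x) ∂μ :=
      lintegral_lintegral_swap (f := fun ω x => g (ω, x)) hg.aemeasurable
    _ = _ := by
      refine lintegral_congr fun x => ?_
      have hslice : (fun ω => g (ω, x)) =
          (Y ⁻¹' Set.Iic x ∩ X ⁻¹' Set.Ioi x).indicator
            fun _ => ENNReal.ofReal (1 + x)⁻¹ := rfl
      rw [hslice, lintegral_indicator_const
          ((hmY measurableSet_Iic).inter (hmX measurableSet_Ioi)), Set.inter_comm,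
        hind.measure_inter_preimage_eq_mul _ _ measurableSet_Ioi measurableSet_Iic, mul_comm]
      rfl

/-- Theorem 5 (strong user, eq. (42)): for independent nonnegative SNRs `X` (user) and
`Y` (eavesdropper) with `E[log₂(1+X)] < ∞`, the average secrecy capacity under the TS
protocol with time fraction `T` is
`E[[T log₂(1+X) − T log₂(1+Y)]⁺] = (T/ln 2) ∫₀^∞ F̄_X(x) F_Y(x)/(1+x) dx`. -/
theorem asc_strong_ts
    {Ω : Type*} [MeasurableSpace Ω] (μ : Measure Ω) [IsProbabilityMeasure μ]
    (X Y : Ω → ℝ) (hmX : Measurable X) (hmY : Measurable Y)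
    (hX0 : ∀ ω, 0 ≤ X ω) (hY0 : ∀ ω, 0 ≤ Y ω)
    (hind : IndepFun X Y μ)
    (hint : Integrable (fun ω => Real.logb 2 (1 + X ω)) μ)
    (T : ℝ) (hT : 0 < T) :
    (∫ ω, max (T * Real.logb 2 (1 + X ω) - T * Real.logb 2 (1 + Y ω)) 0 ∂μ) =
      (T / Real.log 2) *
        ∫ x in Set.Ioi (0 : ℝ),
          (μ {ω | x < X ω}).toReal * (μ {ω | Y ω ≤ x}).toReal / (1 + x) := by
  have hscale : ∀ ω, max (T * logb 2 (1 + X ω) - T * logb 2 (1 + Y ω)) 0 =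
      T / log 2 * max (log (1 + X ω) - log (1 + Y ω)) 0 := fun ω => by
    rw [mul_max_of_nonneg _ _ (div_nonneg hT.le (log_nonneg one_le_two)), mul_zero, logb, logb]
    congr 1
    ring
  simp_rw [hscale]
  rw [integral_const_mul]
  congr 1
  have hmF : Measurable fun x : ℝ => μ {ω | x < X ω} :=
    Antitone.measurable fun x y hxy => measure_mono fun ω (hω : y < X ω) => hxy.trans_lt hω
  have hmG : Measurable fun x : ℝ => μ {ω | Y ω ≤ x} :=
    Monotone.measurable fun x y hxy => measure_mono fun ω (hω : Y ω ≤ x) => hω.trans hxy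
  rw [integral_eq_lintegral_of_nonneg_ae
      (f := fun ω => max (log (1 + X ω) - log (1 + Y ω)) 0) (.of_forall fun ω => le_max_right _ _)
      (Measurable.aestronglyMeasurable (by fun_prop)),
    integral_eq_lintegral_of_nonneg_ae
      (f := fun x => (μ {ω | x < X ω}).toReal * (μ {ω | Y ω ≤ x}).toReal / (1 + x)) ?_
      ((hmF.ennreal_toReal.mul hmG.ennreal_toReal).div (by fun_prop)).aestronglyMeasurable,
    hind.lintegral_log_one_add_sub_log_one_add hmX hmY hX0 hY0]
  · congr 1
    refine lintegral_congr fun x => ?_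
    rw [div_eq_mul_inv, ENNReal.ofReal_mul (by positivity), ENNReal.ofReal_mul (by positivity),
      ENNReal.ofReal_toReal (measure_ne_top _ _), ENNReal.ofReal_toReal (measure_ne_top _ _)]
  · filter_upwards [ae_restrict_mem measurableSet_Ioi] with x hx
    have hx0 : (0 : ℝ) < x := hx
    simp only [Pi.zero_apply]
    positivity
end

section
/- Let X and Y be independent nonnegative real random variables with E[log₂(1 + X)] < ∞, and let β > 0. Then E[ max( log₂(1 + βX) − log₂(1 + βY), 0 ) ] = (1 / ln 2) · ∫₀^∞ P(X > x/β) · P(Y ≤ x/β) / (1 + x) dx. -/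
open MeasureTheory ProbabilityTheory Real

/-- `[log (1 + b) - log (1 + a)]⁺` is the integral of `1 / (1 + x)` over `[a, b)`. -/
lemma lintegral_indicator_Ico_inv_one_add {a b : ℝ} (ha : 0 ≤ a) (hb : 0 ≤ b) :
    ∫⁻ x in Set.Ioi (0 : ℝ), (Set.Ico a b).indicator (fun x => ENNReal.ofReal (1 + x)⁻¹) x =
      ENNReal.ofReal (max (Real.log (1 + b) - Real.log (1 + a)) 0) := by
  have hsub : Set.Ico a b ∩ Set.Ici 0 = Set.Ico a b :=
    Set.inter_eq_left.2 fun x hx => ha.trans hx.1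
  rw [restrict_Ioi_eq_restrict_Ici, lintegral_indicator measurableSet_Ico,
    Measure.restrict_restrict measurableSet_Ico, hsub]
  rcases le_total a b with hab | hba
  · have hcont : ContinuousOn (fun x : ℝ => (1 + x)⁻¹) (Set.uIcc a b) := by
      refine ContinuousOn.inv₀ (by fun_prop) fun x hx => ne_of_gt ?_
      rw [Set.uIcc_of_le hab] at hx
      linarith [hx.1]
    have hii := hcont.intervalIntegrable (μ := volume)
    have hlog : ∫ x in a..b, (1 + x)⁻¹ = Real.log (1 + b) - Real.log (1 + a) := by
      refine intervalIntegral.integral_eq_sub_of_hasDerivAt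
        (f := fun x => Real.log (1 + x)) (fun x hx => ?_) hii
      rw [Set.uIcc_of_le hab] at hx
      have h1 : (1 + x) ≠ 0 := by linarith [hx.1]
      simpa using ((hasDerivAt_id x).const_add 1).log h1
    have hmono : Real.log (1 + a) ≤ Real.log (1 + b) :=
      Real.log_le_log (by linarith) (by linarith)
    rw [max_eq_left (by linarith), ← hlog, intervalIntegral.integral_of_le hab,
      restrict_Ico_eq_restrict_Ioc,
      ofReal_integral_eq_lintegral_ofReal
        ((intervalIntegrable_iff_integrableOn_Ioc_of_le hab).1 hii)]
    filter_upwards [ae_restrict_mem measurableSet_Ioc] with x hx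
    have : 0 ≤ x := ha.trans hx.1.le
    simp only [Pi.zero_apply]
    positivity
  · rw [Set.Ico_eq_empty (not_lt.2 hba)]
    have hmono : Real.log (1 + b) ≤ Real.log (1 + a) :=
      Real.log_le_log (by linarith) (by linarith)
    simp [max_eq_right (sub_nonpos.2 hmono)]

/-- Theorem 6 (ES protocol): for independent nonnegative SNRs `X` (user) and `Y`
(eavesdropper) with `E[log₂(1+X)] < ∞` and energy-splitting ratio `β`,
`E[[log₂(1+βX) − log₂(1+βY)]⁺] = (1/ln 2) ∫₀^∞ F̄_X(x/β) F_Y(x/β)/(1+x) dx`. -/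
theorem asc_es
    {Ω : Type*} [MeasurableSpace Ω] (μ : Measure Ω) [IsProbabilityMeasure μ]
    (X Y : Ω → ℝ) (hmX : Measurable X) (hmY : Measurable Y)
    (hX0 : ∀ ω, 0 ≤ X ω) (hY0 : ∀ ω, 0 ≤ Y ω)
    (hind : IndepFun X Y μ)
    (hint : Integrable (fun ω => Real.logb 2 (1 + X ω)) μ)
    (β : ℝ) (hβ : 0 < β) :
    (∫ ω, max (Real.logb 2 (1 + β * X ω) - Real.logb 2 (1 + β * Y ω)) 0 ∂μ) =
      (1 / Real.log 2) *
        ∫ x in Set.Ioi (0 : ℝ),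
          (μ {ω | x / β < X ω}).toReal * (μ {ω | Y ω ≤ x / β}).toReal / (1 + x) := by
  have hscale : ∀ ω, max (Real.logb 2 (1 + β * X ω) - Real.logb 2 (1 + β * Y ω)) 0 =
      (1 / Real.log 2) * max (Real.log (1 + β * X ω) - Real.log (1 + β * Y ω)) 0 := by
    intro ω
    rw [mul_max_of_nonneg _ _ (one_div_nonneg.2 (Real.log_nonneg one_le_two)), mul_zero]
    congr 1
    simp only [Real.logb]
    ring
  simp_rw [hscale]
  rw [integral_const_mul]
  congr 1
  have hprob : ∀ x, μ {ω | x ∈ Set.Ico (β * Y ω) (β * X ω)} =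
      μ {ω | x / β < X ω} * μ {ω | Y ω ≤ x / β} := by
    intro x
    have hset : {ω | x ∈ Set.Ico (β * Y ω) (β * X ω)} =
        X ⁻¹' Set.Ioi (x / β) ∩ Y ⁻¹' Set.Iic (x / β) := by
      ext ω
      simp only [Set.mem_ofPred_eq, Set.mem_Ico, Set.mem_inter_iff, Set.mem_preimage,
        Set.mem_Ioi, Set.mem_Iic, div_lt_iff₀' hβ, le_div_iff₀' hβ]
      exact and_comm
    rw [hset, hind.measure_inter_preimage_eq_mul _ _ measurableSet_Ioi measurableSet_Iic]
    rfl
  have hmS : MeasurableSet {p : Ω × ℝ | p.2 ∈ Set.Ico (β * Y p.1) (β * X p.1)} := by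
    simp only [Set.mem_Ico]
    exact (measurableSet_le (f := fun p : Ω × ℝ => β * Y p.1) (by fun_prop) (by fun_prop)).inter
      (measurableSet_lt (g := fun p : Ω × ℝ => β * X p.1) (by fun_prop) (by fun_prop))
  have hmF : Measurable (fun p : Ω × ℝ =>
      (Set.Ico (β * Y p.1) (β * X p.1)).indicator
        (fun x => ENNReal.ofReal (1 + x)⁻¹) p.2) :=
    Measurable.indicator (f := fun p : Ω × ℝ => ENNReal.ofReal (1 + p.2)⁻¹)
      (by fun_prop) hmS
  have hXanti : Antitone fun x => μ {ω | x / β < X ω} := fun x y hxy =>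
    measure_mono fun ω hω => lt_of_le_of_lt (div_le_div_of_nonneg_right hxy hβ.le) hω
  have hYmono : Monotone fun x => μ {ω | Y ω ≤ x / β} := fun x y hxy =>
    measure_mono fun ω hω => le_trans hω (div_le_div_of_nonneg_right hxy hβ.le)
  have hmG : Measurable fun x : ℝ =>
      (μ {ω | x / β < X ω}).toReal * (μ {ω | Y ω ≤ x / β}).toReal / (1 + x) :=
    (hXanti.measurable.ennreal_toReal.mul hYmono.measurable.ennreal_toReal).div (by fun_prop)
  rw [integral_eq_lintegral_of_nonneg_ae (.of_forall fun ω => by simp)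
      (by fun_prop),
    integral_eq_lintegral_of_nonneg_ae _ hmG.aestronglyMeasurable]
  · congr 1
    simp_rw [← fun ω => lintegral_indicator_Ico_inv_one_add
      (mul_nonneg hβ.le (hY0 ω)) (mul_nonneg hβ.le (hX0 ω))]
    rw [lintegral_lintegral_swap hmF.aemeasurable]
    refine lintegral_congr fun x => ?_
    have hmx : MeasurableSet {ω | x ∈ Set.Ico (β * Y ω) (β * X ω)} :=
      measurable_prodMk_right hmS
    calc ∫⁻ ω, (Set.Ico (β * Y ω) (β * X ω)).indicator (fun x => ENNReal.ofReal (1 + x)⁻¹) x ∂μ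
        = ∫⁻ ω, {ω | x ∈ Set.Ico (β * Y ω) (β * X ω)}.indicator
            (fun _ => ENNReal.ofReal (1 + x)⁻¹) ω ∂μ := rfl
      _ = ENNReal.ofReal (1 + x)⁻¹ * (μ {ω | x / β < X ω} * μ {ω | Y ω ≤ x / β}) := by
          rw [lintegral_indicator_const hmx, hprob]
      _ = _ := by
          rw [div_eq_mul_inv _ (1 + x), ENNReal.ofReal_mul (by positivity),
            ENNReal.ofReal_mul (by positivity), ENNReal.ofReal_toReal (measure_ne_top _ _),
            ENNReal.ofReal_toReal (measure_ne_top _ _), mul_comm]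
  · filter_upwards [ae_restrict_mem measurableSet_Ioi] with x hx
    have : 0 < x := hx
    simp only [Pi.zero_apply]
    positivity
end

section
/- Let H and X be nonnegative real random variables on a probability space with H > 0 almost surely. Let 0 < a_s < a_w, T > 0, R > 0 with 2^{R/T}·a_s < 1, and set B = 2^{−R/T}·(1 + a_w/a_s) − 1 > 0. Assume P(X = B) = 0. For ρ > 0 define the secrecy-outage event A(ρ) = { T·log₂(1 + a_w ρ H/(a_s ρ H + 1)) − T·log₂(1 + X) < R }. Then P(A(ρ)) → P(X > B) as ρ → ∞. -/
open MeasureTheory ProbabilityTheory Filter Real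

/-- The received signal-to-interference-plus-noise ratio saturates at the ratio of the
power-allocation coefficients. -/
theorem tendsto_sinr_atTop {a b h : ℝ} (hb : 0 < b) (hh : 0 < h) :
    Tendsto (fun ρ : ℝ => a * ρ * h / (b * ρ * h + 1)) atTop (nhds (a / b)) := by
  have hden : Tendsto (fun ρ : ℝ => b * ρ * h + 1) atTop atTop :=
    tendsto_atTop_add_const_right _ _
      ((tendsto_id.const_mul_atTop hb).atTop_mul_const hh)
  have hlim := (tendsto_inv_atTop_zero.comp hden).const_mul (a / b)
  have hsub := (tendsto_const_nhds (x := a / b)).sub hlim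
  rw [mul_zero, sub_zero] at hsub
  refine hsub.congr' ?_
  filter_upwards [hden.eventually_gt_atTop 0] with ρ hρ
  have := hρ.ne'
  simp only [Function.comp_apply]
  field_simp
  ring

/-- A function converging to `l ≠ r` is eventually below `r` exactly when `l` is. -/
theorem eventually_lt_iff_of_tendsto {α : Type*} {F : Filter α} {f : α → ℝ} {l r : ℝ}
    (hf : Tendsto f F (nhds l)) (hlr : l ≠ r) : ∀ᶠ x in F, (f x < r ↔ l < r) := by
  rcases lt_or_gt_of_ne hlr with h | h
  · filter_upwards [hf.eventually_lt_const h] with x hx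
    exact iff_of_true hx h
  · filter_upwards [hf.eventually_const_lt h] with x hx
    exact iff_of_false hx.not_gt h.not_gt

/-- The logarithmic form of the secrecy threshold `2 ^ (-(R / T)) * c - 1`. -/
theorem mul_logb_threshold {T R c : ℝ} (hT : T ≠ 0) (hc : 0 < c) :
    T * Real.logb 2 c = R + T * Real.logb 2 (2 ^ (-(R / T)) * c) := by
  rw [Real.logb_mul (by positivity) hc.ne', Real.logb_rpow (by norm_num) (by norm_num)]
  field_simp
  ring

/-- Corollary 3 (error floor of the weak user): as `ρ → ∞`, the weak user's secrecy
outage probability `P(T log₂(1 + a_w ρ H/(a_s ρ H + 1)) − T log₂(1 + X) < R)` tends to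
the error floor `P(X > B)` with `B = 2^{−R/T}(1 + a_w/a_s) − 1 > 0`. -/
theorem weak_user_error_floor
    {Ω : Type*} [MeasurableSpace Ω] (μ : Measure Ω) [IsProbabilityMeasure μ]
    (H X : Ω → ℝ) (hmH : Measurable H) (hmX : Measurable X)
    (hH : ∀ᵐ ω ∂μ, 0 < H ω) (hX0 : ∀ ω, 0 ≤ X ω)
    (a_s a_w T R : ℝ) (has : 0 < a_s) (hsw : a_s < a_w) (hT : 0 < T) (hR : 0 < R)
    (hth : (2 : ℝ) ^ (R / T) * a_s < 1)
    (B : ℝ) (hB : B = (2 : ℝ) ^ (-(R / T)) * (1 + a_w / a_s) - 1) (hBpos : 0 < B)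
    (hXB : μ {ω | X ω = B} = 0) :
    Tendsto (fun ρ : ℝ =>
        (μ {ω | T * Real.logb 2 (1 + a_w * ρ * H ω / (a_s * ρ * H ω + 1))
          - T * Real.logb 2 (1 + X ω) < R}).toReal)
      atTop (nhds ((μ {ω | B < X ω}).toReal)) := by
  have haw : 0 < a_w := has.trans hsw
  have hc : 0 < 1 + a_w / a_s := by positivity
  have hB1 : (2 : ℝ) ^ (-(R / T)) * (1 + a_w / a_s) = 1 + B := by rw [hB]; ring
  have hlog : T * Real.logb 2 (1 + a_w / a_s) = R + T * Real.logb 2 (1 + B) := by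
    rw [mul_logb_threshold hT.ne' hc, hB1]
  have hXne : ∀ᵐ ω ∂μ, X ω ≠ B := by
    simpa [ae_iff] using hXB
  refine (ENNReal.tendsto_toReal (measure_ne_top μ _)).comp ?_
  refine tendsto_measure_of_ae_tendsto_indicator_of_isFiniteMeasure atTop
    (measurableSet_lt measurable_const hmX)
    (fun ρ => measurableSet_lt (by unfold Real.logb; fun_prop) measurable_const) ?_
  filter_upwards [hH, hXne] with ω hω hne
  have hX1 : 0 < 1 + X ω := by linarith [hX0 ω]
  have hlim : Tendsto (fun ρ : ℝ =>
      T * Real.logb 2 (1 + a_w * ρ * H ω / (a_s * ρ * H ω + 1)) - T * Real.logb 2 (1 + X ω))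
      atTop (nhds (T * Real.logb 2 (1 + a_w / a_s) - T * Real.logb 2 (1 + X ω))) :=
    ((((tendsto_sinr_atTop has hω).const_add 1).log hc.ne').div_const _
      |>.const_mul T).sub_const _
  have hlt : T * Real.logb 2 (1 + a_w / a_s) - T * Real.logb 2 (1 + X ω) < R ↔ B < X ω := by
    rw [hlog, add_sub_assoc, add_lt_iff_neg_left, sub_neg, mul_lt_mul_iff_right₀ hT,
      Real.logb_lt_logb_iff (by norm_num) (by linarith) hX1, add_lt_add_iff_left]
  have hlimit_ne : T * Real.logb 2 (1 + a_w / a_s) - T * Real.logb 2 (1 + X ω) ≠ R := by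
    intro h
    have h1 : Real.logb 2 (1 + X ω) = Real.logb 2 (1 + B) :=
      mul_left_cancel₀ hT.ne' (by linarith)
    have h2 := Real.logb_injOn_pos (by norm_num : (1 : ℝ) < 2) hX1
      (by linarith : 0 < 1 + B) h1
    exact hne (by linarith)
  filter_upwards [eventually_lt_iff_of_tendsto hlim hlimit_ne] with ρ hρ
  exact hρ.trans hlt
end

section
/- Let 0 < δ < 1, m > 0, b₁, b₂ > 0, and define the density f(x) = δ·m·(b₁^{−δ} + b₂^{−δ})·x^{−δ−1}·exp(−m·(b₁^{−δ} + b₂^{−δ})·x^{−δ}) for x > 0. Let F : [0,∞) → [0,1] be a nondecreasing function with F(0) = 0 such that F(t)/t^β → L as t → 0⁺ for some constants L > 0 and β > δ. Let g(x) = (2^R·(β_s x + 1) − 1)/(β_s a_s) for constants R > 0, β_s ∈ (0,1), a_s > 0. Define P(ρ) = ∫₀^∞ F( g(x)/ρ )·f(x) dx for ρ > 0. Then −ln P(ρ) / ln ρ → δ as ρ → ∞; that is, the secrecy diversity order equals δ. -/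
open MeasureTheory Filter Real

/-- Two-sided power bounds on a function determine its logarithmic decay rate. -/
lemma tendsto_neg_log_div_log_of_rpow_bounds {P : ℝ → ℝ} {δ K : ℝ} (hδ : 0 < δ) (hK : 0 < K)
    (hlow : ∀ ρ, 1 ≤ ρ → K * ρ ^ (-δ) ≤ P ρ)
    (hupp : ∀ γ, 0 < γ → γ < δ → ∃ C, ∀ ρ, 1 ≤ ρ → P ρ ≤ C * ρ ^ (-γ)) :
    Tendsto (fun ρ : ℝ => -log (P ρ) / log ρ) atTop (nhds δ) := by
  have hlim : ∀ e C : ℝ, Tendsto (fun ρ : ℝ => e - log C / log ρ) atTop (nhds e) := by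
    intro e C
    simpa using tendsto_const_nhds.sub (tendsto_log_atTop.const_div_atTop (log C))
  refine tendsto_order.2 ⟨fun a ha => ?_, fun a ha => ?_⟩
  · obtain ⟨γ, h1, h2⟩ := exists_between (max_lt ha hδ)
    obtain ⟨haγ, hγ⟩ := max_lt_iff.1 h1
    obtain ⟨C, hC⟩ := hupp γ hγ h2
    filter_upwards [(hlim γ C).eventually (lt_mem_nhds haγ), eventually_gt_atTop 1] with ρ h3 h4
    refine h3.trans_le ?_
    have hρ : 0 < ρ := by linarith
    have hlog := log_pos h4
    have hPpos : 0 < P ρ := lt_of_lt_of_le (by positivity) (hlow ρ h4.le)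
    have hle := hC ρ h4.le
    have hCpos : 0 < C := pos_of_mul_pos_left (hPpos.trans_le hle) (by positivity)
    have := log_le_log hPpos hle
    rw [log_mul hCpos.ne' (by positivity), log_rpow hρ] at this
    rw [le_div_iff₀ hlog, sub_mul, div_mul_cancel₀ _ hlog.ne']
    linarith
  · filter_upwards [(hlim δ K).eventually (gt_mem_nhds ha), eventually_gt_atTop 1] with ρ h3 h4
    refine lt_of_le_of_lt ?_ h3
    have hρ : 0 < ρ := by linarith
    have hlog := log_pos h4
    have := log_le_log (by positivity) (hlow ρ h4.le)
    rw [log_mul hK.ne' (by positivity), log_rpow hρ] at this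
    rw [div_le_iff₀ hlog, sub_mul, div_mul_cancel₀ _ hlog.ne']
    linarith

/-- The Fréchet density with shape `δ` and scale parameter `c`. -/
noncomputable def frechetDensity (δ c x : ℝ) : ℝ :=
  δ * c * x ^ (-δ - 1) * exp (-c * x ^ (-δ))

lemma frechetDensity_nonneg {δ c x : ℝ} (hδ : 0 < δ) (hc : 0 < c) (hx : 0 < x) :
    0 ≤ frechetDensity δ c x := by
  unfold frechetDensity
  positivity

lemma frechetDensity_le {δ c x : ℝ} (hδ : 0 < δ) (hc : 0 < c) (hx : 0 < x) :
    frechetDensity δ c x ≤ δ * c * x ^ (-δ - 1) := by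
  unfold frechetDensity
  refine mul_le_of_le_one_right (by positivity) (exp_le_one_iff.2 ?_)
  have : 0 < c * x ^ (-δ) := by positivity
  linarith

lemma hasDerivAt_exp_neg_mul_rpow_neg (δ c : ℝ) {x : ℝ} (hx : 0 < x) :
    HasDerivAt (fun x => exp (-c * x ^ (-δ))) (frechetDensity δ c x) x := by
  have h := ((hasDerivAt_rpow_const (p := -δ) (Or.inl hx.ne')).const_mul (-c)).exp
  convert h using 1
  unfold frechetDensity
  ring

lemma tendsto_exp_neg_mul_rpow_neg {δ : ℝ} (c : ℝ) (hδ : 0 < δ) :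
    Tendsto (fun x : ℝ => exp (-c * x ^ (-δ))) atTop (nhds 1) := by
  have h := ((tendsto_rpow_neg_atTop hδ).const_mul (-c)).rexp
  simpa using h

lemma integrableOn_frechetDensity {δ c a : ℝ} (hδ : 0 < δ) (hc : 0 < c) (ha : 0 < a) :
    IntegrableOn (frechetDensity δ c) (Set.Ioi a) :=
  integrableOn_Ioi_deriv_of_nonneg
    (hasDerivAt_exp_neg_mul_rpow_neg δ c ha).continuousAt.continuousWithinAt
    (fun _ hx => hasDerivAt_exp_neg_mul_rpow_neg δ c (ha.trans hx))
    (fun _ hx => frechetDensity_nonneg hδ hc (ha.trans hx))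
    (tendsto_exp_neg_mul_rpow_neg c hδ)

lemma integral_Ioi_frechetDensity {δ c a : ℝ} (hδ : 0 < δ) (hc : 0 < c) (ha : 0 < a) :
    ∫ x in Set.Ioi a, frechetDensity δ c x = 1 - exp (-c * a ^ (-δ)) :=
  integral_Ioi_of_hasDerivAt_of_nonneg
    (hasDerivAt_exp_neg_mul_rpow_neg δ c ha).continuousAt.continuousWithinAt
    (fun _ hx => hasDerivAt_exp_neg_mul_rpow_neg δ c (ha.trans hx))
    (fun _ hx => frechetDensity_nonneg hδ hc (ha.trans hx))
    (tendsto_exp_neg_mul_rpow_neg c hδ)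

lemma continuousOn_frechetDensity (δ c : ℝ) :
    ContinuousOn (frechetDensity δ c) (Set.Ioi 0) := by
  unfold frechetDensity
  have h : ∀ p : ℝ, ContinuousOn (fun x : ℝ => x ^ p) (Set.Ioi 0) := fun p =>
    continuousOn_id.rpow_const fun x hx => Or.inl (ne_of_gt hx)
  exact (continuousOn_const.mul (h _)).mul (continuousOn_const.mul (h _)).rexp

lemma integrableOn_Ioi_zero_frechetDensity {δ c : ℝ} (hδ : 0 < δ) (hc : 0 < c) :
    IntegrableOn (frechetDensity δ c) (Set.Ioi 0) := by
  have hlim : Tendsto (fun x : ℝ => exp (-c * x ^ (-δ))) (nhdsWithin 0 (Set.Ioi 0)) (nhds 0) :=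
    tendsto_exp_atBot.comp
      ((tendsto_rpow_neg_nhdsGT_zero (neg_lt_zero.2 hδ)).const_mul_atTop_of_neg
        (neg_lt_zero.2 hc))
  have heq : ∀ x : ℝ, 0 < x → Function.update (fun x : ℝ => exp (-c * x ^ (-δ))) 0 0 x =
      exp (-c * x ^ (-δ)) := fun x hx => Function.update_of_ne hx.ne' _ _
  refine integrableOn_Ioi_deriv_of_nonneg (l := 1)
    (g := Function.update (fun x : ℝ => exp (-c * x ^ (-δ))) 0 0)
    (continuousWithinAt_update_same.2 (by rwa [Set.Ici_sdiff_left])) (fun x hx => ?_)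
    (fun x hx => frechetDensity_nonneg hδ hc hx) ?_
  · exact (hasDerivAt_exp_neg_mul_rpow_neg δ c hx).congr_of_eventuallyEq
      ((eventually_gt_nhds hx).mono heq)
  · exact (tendsto_exp_neg_mul_rpow_neg c hδ).congr'
      ((eventually_gt_atTop 0).mono fun x hx => (heq x hx).symm)

lemma integrableOn_rpow_mul_frechetDensity {δ c γ A B : ℝ} (hδ : 0 < δ) (hc : 0 < c)
    (hγ : 0 < γ) (hγδ : γ < δ) (hA : 0 < A) (hB : 0 < B) :
    IntegrableOn (fun x => (A * x + B) ^ γ * frechetDensity δ c x) (Set.Ioi 0) := by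
  have hmeas : ∀ s ⊆ Set.Ioi (0 : ℝ), MeasurableSet s → AEStronglyMeasurable
      (fun x => (A * x + B) ^ γ * frechetDensity δ c x) (volume.restrict s) := by
    intro s hs hsm
    refine ContinuousOn.aestronglyMeasurable (ContinuousOn.mul ?_
      ((continuousOn_frechetDensity δ c).mono hs)) hsm
    refine ContinuousOn.rpow_const (by fun_prop) fun _ _ => Or.inr hγ.le
  rw [← Set.Ioc_union_Ioi_eq_Ioi (zero_le_one' ℝ)]
  refine IntegrableOn.union ?_ ?_
  · refine Integrable.mono' (((integrableOn_Ioi_zero_frechetDensity hδ hc).mono_set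
      Set.Ioc_subset_Ioi_self).const_mul ((A + B) ^ γ))
      (hmeas _ Set.Ioc_subset_Ioi_self measurableSet_Ioc) ?_
    filter_upwards [ae_restrict_mem measurableSet_Ioc] with x ⟨hx0, hx1⟩
    have hf := frechetDensity_nonneg hδ hc hx0
    rw [norm_of_nonneg (by positivity)]
    gcongr
    nlinarith
  · have hsub : Set.Ioi (1 : ℝ) ⊆ Set.Ioi 0 := Set.Ioi_subset_Ioi zero_le_one
    refine Integrable.mono' ((integrableOn_Ioi_rpow_of_lt
      (show γ - δ - 1 < -1 by linarith) zero_lt_one).const_mul ((A + B) ^ γ * (δ * c)))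
      (hmeas _ hsub measurableSet_Ioi) ?_
    filter_upwards [ae_restrict_mem measurableSet_Ioi] with x hx
    have hx1 : 1 < x := hx
    have hx0 : 0 < x := by linarith
    have hf := frechetDensity_nonneg hδ hc hx0
    rw [norm_of_nonneg (by positivity)]
    calc (A * x + B) ^ γ * frechetDensity δ c x
        ≤ ((A + B) * x) ^ γ * (δ * c * x ^ (-δ - 1)) := by
          gcongr
          · nlinarith
          · exact frechetDensity_le hδ hc hx0
      _ = (A + B) ^ γ * (δ * c) * x ^ (γ - δ - 1) := by
          rw [mul_rpow (by positivity) hx0.le, show γ - δ - 1 = γ + (-δ - 1) by ring,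
            rpow_add hx0]
          ring

/-- A bounded function of order `t ^ β` at `0` is dominated by `t ^ γ` whenever `0 < γ < β`. -/
lemma exists_le_mul_rpow_of_tendsto_div_rpow {F : ℝ → ℝ} {L β γ : ℝ}
    (hF : ∀ t ≥ (0 : ℝ), F t ∈ Set.Icc (0 : ℝ) 1) (hL : 0 < L)
    (hFasym : Tendsto (fun t => F t / t ^ β) (nhdsWithin 0 (Set.Ioi 0)) (nhds L))
    (hγ : 0 < γ) (hγβ : γ < β) :
    ∃ C, ∀ t, 0 < t → F t ≤ C * t ^ γ := by
  obtain ⟨u, hu0, hu⟩ := mem_nhdsGT_iff_exists_Ioo_subset.1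
    (hFasym.eventually (gt_mem_nhds (lt_add_one L)))
  have hs : 0 < min u 1 := lt_min hu0 one_pos
  refine ⟨L + 1 + (min u 1) ^ (-γ), fun t ht => ?_⟩
  have htγ : 0 < t ^ γ := by positivity
  rcases lt_or_ge t (min u 1) with h | h
  · obtain ⟨h1, h2⟩ := lt_min_iff.1 h
    have h3 : F t / t ^ β < L + 1 := hu ⟨ht, h1⟩
    rw [div_lt_iff₀ (by positivity)] at h3
    have h4 : t ^ β ≤ t ^ γ := rpow_le_rpow_of_exponent_ge ht h2.le hγβ.le
    have h5 : (0 : ℝ) < (min u 1) ^ (-γ) := by positivity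
    nlinarith
  · have h1 := (hF t ht.le).2
    have h2 : (min u 1) ^ γ ≤ t ^ γ := by gcongr
    have h3 : 1 ≤ (min u 1) ^ (-γ) * t ^ γ := by
      rw [rpow_neg hs.le, inv_mul_eq_div, one_le_div (by positivity)]
      exact h2
    nlinarith

lemma mul_div_one_add_le_one_sub_exp_neg_mul {y r : ℝ} (hy : 0 ≤ y) (hr0 : 0 ≤ r)
    (hr : r ≤ 1) : y / (1 + y) * r ≤ 1 - exp (-(y * r)) := by
  have hyr : 0 ≤ y * r := by positivity
  have h1 : exp (-(y * r)) ≤ 1 / (1 + y * r) := by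
    rw [exp_neg, ← one_div]
    refine one_div_le_one_div_of_le (by positivity) ?_
    linarith [add_one_le_exp (y * r)]
  have h2 : y / (1 + y) * r ≤ 1 - 1 / (1 + y * r) := by
    rw [one_sub_div (by positivity), div_mul_eq_mul_div, add_sub_cancel_left]
    gcongr
    exact mul_le_of_le_one_right hy hr
  linarith

section AffineMixture

variable {F : ℝ → ℝ} {δ c A B : ℝ}

lemma integrableOn_comp_affine_mul_frechetDensity (hδ : 0 < δ) (hc : 0 < c) (hA : 0 < A)
    (hB : 0 < B) (hFmono : MonotoneOn F (Set.Ici (0 : ℝ)))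
    (hF : ∀ t ≥ (0 : ℝ), F t ∈ Set.Icc (0 : ℝ) 1) {ρ : ℝ} (hρ : 0 < ρ) :
    IntegrableOn (fun x => F ((A * x + B) / ρ) * frechetDensity δ c x) (Set.Ioi 0) := by
  refine Integrable.bdd_mul (c := 1) (integrableOn_Ioi_zero_frechetDensity hδ hc) ?_ ?_
  · refine (aemeasurable_restrict_of_monotoneOn measurableSet_Ioi ?_).aestronglyMeasurable
    intro x hx y hy hxy
    have hx : 0 < x := hx
    have hy : 0 < y := hy
    refine hFmono (Set.mem_Ici.2 (by positivity)) (Set.mem_Ici.2 (by positivity)) ?_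
    gcongr
  · filter_upwards [ae_restrict_mem measurableSet_Ioi] with x hx
    have hx : 0 < x := hx
    obtain ⟨h0, h1⟩ := hF ((A * x + B) / ρ) (by positivity)
    rwa [norm_of_nonneg h0]

lemma integral_comp_affine_mul_frechetDensity_le (hδ : 0 < δ) (hc : 0 < c) (hA : 0 < A)
    (hB : 0 < B) (hF : ∀ t ≥ (0 : ℝ), F t ∈ Set.Icc (0 : ℝ) 1) {C γ : ℝ}
    (hγ : 0 < γ) (hγδ : γ < δ) (hFC : ∀ t, 0 < t → F t ≤ C * t ^ γ) {ρ : ℝ} (hρ : 0 < ρ) :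
    ∫ x in Set.Ioi (0 : ℝ), F ((A * x + B) / ρ) * frechetDensity δ c x ≤
      (C * ∫ x in Set.Ioi (0 : ℝ), (A * x + B) ^ γ * frechetDensity δ c x) * ρ ^ (-γ) := by
  have hint := integrableOn_rpow_mul_frechetDensity hδ hc hγ hγδ hA hB
  rw [mul_right_comm, ← integral_const_mul]
  refine integral_mono_of_nonneg ?_ (hint.const_mul _) ?_
  · filter_upwards [ae_restrict_mem measurableSet_Ioi] with x hx
    have hx : 0 < x := hx
    exact mul_nonneg (hF _ (by positivity)).1 (frechetDensity_nonneg hδ hc hx)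
  · filter_upwards [ae_restrict_mem measurableSet_Ioi] with x hx
    have hx : 0 < x := hx
    have h := mul_le_mul_of_nonneg_right (hFC ((A * x + B) / ρ) (by positivity))
      (frechetDensity_nonneg hδ hc hx)
    refine h.trans_eq ?_
    rw [div_rpow (by positivity) hρ.le, rpow_neg hρ.le]
    ring

lemma le_integral_comp_affine_mul_frechetDensity (hδ : 0 < δ) (hc : 0 < c) (hA : 0 < A)
    (hB : 0 < B) (hFmono : MonotoneOn F (Set.Ici (0 : ℝ)))
    (hF : ∀ t ≥ (0 : ℝ), F t ∈ Set.Icc (0 : ℝ) 1) {t : ℝ} (ht : 0 < t) {ρ : ℝ} (hρ : 1 ≤ ρ) :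
    F t * (c * (t / A) ^ (-δ) / (1 + c * (t / A) ^ (-δ))) * ρ ^ (-δ) ≤
      ∫ x in Set.Ioi (0 : ℝ), F ((A * x + B) / ρ) * frechetDensity δ c x := by
  have hρ0 : 0 < ρ := by linarith
  have ha : 0 < t / A * ρ := by positivity
  have hsub : Set.Ioi (t / A * ρ) ⊆ Set.Ioi 0 := Set.Ioi_subset_Ioi ha.le
  have hint := integrableOn_comp_affine_mul_frechetDensity hδ hc hA hB hFmono hF hρ0
  calc F t * (c * (t / A) ^ (-δ) / (1 + c * (t / A) ^ (-δ))) * ρ ^ (-δ)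
      ≤ F t * (1 - exp (-(c * (t / A) ^ (-δ) * ρ ^ (-δ)))) := by
        rw [mul_assoc]
        exact mul_le_mul_of_nonneg_left (mul_div_one_add_le_one_sub_exp_neg_mul
          (by positivity) (by positivity) (rpow_le_one_of_one_le_of_nonpos hρ (by linarith)))
          (hF t ht.le).1
    _ = ∫ x in Set.Ioi (t / A * ρ), F t * frechetDensity δ c x := by
        rw [integral_const_mul, integral_Ioi_frechetDensity hδ hc ha,
          mul_rpow (by positivity) hρ0.le]
        ring_nf
    _ ≤ ∫ x in Set.Ioi (t / A * ρ), F ((A * x + B) / ρ) * frechetDensity δ c x := by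
        refine setIntegral_mono_on ((integrableOn_frechetDensity hδ hc ha).const_mul _)
          (hint.mono_set hsub) measurableSet_Ioi fun x hx => ?_
        have hx0 : 0 < x := hsub hx
        have hx : t / A * ρ < x := hx
        refine mul_le_mul_of_nonneg_right (hFmono ht.le (Set.mem_Ici.2 (by positivity)) ?_)
          (frechetDensity_nonneg hδ hc hx0)
        rw [div_mul_eq_mul_div, div_lt_iff₀ hA] at hx
        rw [le_div_iff₀ hρ0]
        linarith
    _ ≤ ∫ x in Set.Ioi (0 : ℝ), F ((A * x + B) / ρ) * frechetDensity δ c x := by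
        refine setIntegral_mono_set hint ?_ hsub.eventuallyLE
        filter_upwards [ae_restrict_mem measurableSet_Ioi] with x hx
        have hx : 0 < x := hx
        exact mul_nonneg (hF _ (by positivity)).1 (frechetDensity_nonneg hδ hc hx)

end AffineMixture

/-- Corollary 2 (ES protocol): the secrecy diversity order of the strong user equals
`δ`. Here `f` is the most-detrimental-eavesdropper density of Lemma 5, `F` is the channel
power CDF with `F(t) ~ L t^β` near `0⁺` (`β > δ`, Lemma 7), `g` the ES outage threshold
map, and `P(ρ) = ∫₀^∞ F(g(x)/ρ) f(x) dx`; then `−ln P(ρ)/ln ρ → δ` as `ρ → ∞`. -/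
theorem secrecy_diversity_order_es
    (δ m b₁ b₂ : ℝ) (hδ0 : 0 < δ) (hδ1 : δ < 1) (hm : 0 < m) (hb₁ : 0 < b₁) (hb₂ : 0 < b₂)
    (f : ℝ → ℝ)
    (hf : ∀ x > (0 : ℝ), f x = δ * m * (b₁ ^ (-δ) + b₂ ^ (-δ)) * x ^ (-δ - 1) *
      Real.exp (-m * (b₁ ^ (-δ) + b₂ ^ (-δ)) * x ^ (-δ)))
    (F : ℝ → ℝ) (hFmono : MonotoneOn F (Set.Ici (0 : ℝ))) (hF0 : F 0 = 0)
    (hFrange : ∀ t ≥ (0 : ℝ), F t ∈ Set.Icc (0 : ℝ) 1)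
    (L β : ℝ) (hL : 0 < L) (hβ : δ < β)
    (hFasym : Tendsto (fun t => F t / t ^ β) (nhdsWithin 0 (Set.Ioi 0)) (nhds L))
    (R β_s a_s : ℝ) (hR : 0 < R) (hβs : β_s ∈ Set.Ioo (0 : ℝ) 1) (has : 0 < a_s)
    (g : ℝ → ℝ) (hg : ∀ x, g x = ((2 : ℝ) ^ R * (β_s * x + 1) - 1) / (β_s * a_s))
    (P : ℝ → ℝ) (hP : ∀ ρ > (0 : ℝ), P ρ = ∫ x in Set.Ioi (0 : ℝ), F (g x / ρ) * f x) :
    Tendsto (fun ρ : ℝ => -Real.log (P ρ) / Real.log ρ) atTop (nhds δ) := by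
  obtain ⟨hβ0, -⟩ := hβs
  have hc : 0 < m * (b₁ ^ (-δ) + b₂ ^ (-δ)) := by positivity
  have hA : 0 < (2 : ℝ) ^ R / a_s := by positivity
  have hB : 0 < ((2 : ℝ) ^ R - 1) / (β_s * a_s) :=
    div_pos (sub_pos.2 (one_lt_rpow one_lt_two hR)) (by positivity)
  have hP' : ∀ ρ > (0 : ℝ), P ρ = ∫ x in Set.Ioi (0 : ℝ),
      F (((2 : ℝ) ^ R / a_s * x + ((2 : ℝ) ^ R - 1) / (β_s * a_s)) / ρ) *
        frechetDensity δ (m * (b₁ ^ (-δ) + b₂ ^ (-δ))) x := by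
    intro ρ hρ
    rw [hP ρ hρ]
    refine setIntegral_congr_fun measurableSet_Ioi fun x hx => ?_
    have hgx : g x = (2 : ℝ) ^ R / a_s * x + ((2 : ℝ) ^ R - 1) / (β_s * a_s) := by
      rw [hg]
      field_simp
      ring
    simp only [hgx, hf x hx, frechetDensity]
    ring_nf
  obtain ⟨t, hFt, ht⟩ := ((hFasym.eventually (lt_mem_nhds hL)).and self_mem_nhdsWithin).exists
  have ht : 0 < t := ht
  have hFt : 0 < F t := (div_pos_iff_of_pos_right (by positivity)).1 hFt
  have hy : 0 < m * (b₁ ^ (-δ) + b₂ ^ (-δ)) * (t / ((2 : ℝ) ^ R / a_s)) ^ (-δ) := by positivity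
  refine tendsto_neg_log_div_log_of_rpow_bounds hδ0
    (mul_pos hFt (div_pos hy (add_pos one_pos hy))) (fun ρ hρ => ?_) fun γ hγ hγδ => ?_
  · rw [hP' ρ (by linarith)]
    exact le_integral_comp_affine_mul_frechetDensity hδ0 hc hA hB hFmono hFrange ht hρ
  · obtain ⟨C, hC⟩ :=
      exists_le_mul_rpow_of_tendsto_div_rpow hFrange hL hFasym hγ (hγδ.trans hβ)
    exact ⟨_, fun ρ hρ => (hP' ρ (zero_lt_one.trans_le hρ)).trans_le
      (integral_comp_affine_mul_frechetDensity_le hδ0 hc hA hB hFrange hγ hγδ hC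
        (zero_lt_one.trans_le hρ))⟩
end

section
/- Let X and Y be independent nonnegative real random variables with E[ln(1 + X)] < ∞. Then E[ max( ln(1+X) − ln(1+Y), 0 ) ] = ∫₀^∞ P(X > x)/(1 + x) dx − ∫₀^∞ P(X > x)·P(Y > x)/(1 + x) dx, where moreover E[ln(1+X)] = ∫₀^∞ P(X > x)/(1 + x) dx. -/
open MeasureTheory ProbabilityTheory Real

/-- Layer-cake formula for `log (1 + Z)`, in terms of the complementary CDF of `Z`. -/
theorem integral_log_one_add_eq_integral_meas_lt {Ω : Type*} [MeasurableSpace Ω]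
    (μ : Measure Ω) [IsFiniteMeasure μ] {Z : Ω → ℝ} (hZ : Measurable Z) (hZ0 : ∀ ω, 0 ≤ Z ω) :
    ∫ ω, Real.log (1 + Z ω) ∂μ =
      ∫ x in Set.Ioi (0 : ℝ), (μ {ω | x < Z ω}).toReal / (1 + x) := by
  have hint : ∀ t : ℝ, 0 ≤ t → IntervalIntegrable (fun x : ℝ => (1 + x)⁻¹) volume 0 t := by
    intro t ht
    refine ContinuousOn.intervalIntegrable (ContinuousOn.inv₀ (by fun_prop) fun x hx => ?_)
    rw [Set.uIcc_of_le ht] at hx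
    linarith [hx.1]
  have hlog : ∀ t : ℝ, 0 ≤ t → ∫ x in (0 : ℝ)..t, (1 + x)⁻¹ = Real.log (1 + t) := by
    intro t ht
    rw [intervalIntegral.integral_comp_add_left (fun x : ℝ => x⁻¹) 1, add_zero,
      integral_inv_of_pos one_pos (by linarith), div_one]
  have hanti : Antitone fun x : ℝ => (μ {ω | x < Z ω}).toReal := fun a b hab =>
    ENNReal.toReal_mono (measure_ne_top _ _) (measure_mono fun ω (h : b < Z ω) => hab.trans_lt h)
  have hmeas : Measurable fun x : ℝ => (μ {ω | x < Z ω}).toReal / (1 + x) :=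
    hanti.measurable.div (measurable_const.add measurable_id)
  rw [integral_eq_lintegral_of_nonneg_ae
      (.of_forall fun ω => Real.log_nonneg (by linarith [hZ0 ω]))
      (hZ.const_add 1).log.aestronglyMeasurable,
    integral_eq_lintegral_of_nonneg_ae
      ((ae_restrict_mem measurableSet_Ioi).mono fun x (hx : 0 < x) => by
        simp only [Pi.zero_apply]; positivity)
      hmeas.aestronglyMeasurable]
  congr 1
  have key := lintegral_comp_eq_lintegral_meas_lt_mul μ (f := Z) (g := fun x : ℝ => (1 + x)⁻¹)
    (.of_forall hZ0) hZ.aemeasurable (fun t ht => hint t ht.le)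
    ((ae_restrict_mem measurableSet_Ioi).mono fun x (hx : 0 < x) => by positivity)
  simp only [hlog _ (hZ0 _)] at key
  rw [key]
  refine lintegral_congr fun x => ?_
  rw [div_eq_mul_inv, ENNReal.ofReal_mul ENNReal.toReal_nonneg,
    ENNReal.ofReal_toReal (measure_ne_top _ _)]

/-- Equation (C.1) (Appendix C): for independent nonnegative SNRs `X`, `Y` with
`E[ln(1+X)] < ∞`, the average secrecy capacity decomposes as `C = C_max − C_loss`:
`E[[ln(1+X) − ln(1+Y)]⁺] = ∫₀^∞ F̄_X(x)/(1+x) dx − ∫₀^∞ F̄_X(x) F̄_Y(x)/(1+x) dx`,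
and moreover `E[ln(1+X)] = ∫₀^∞ F̄_X(x)/(1+x) dx`. -/
theorem asc_decomposition
    {Ω : Type*} [MeasurableSpace Ω] (μ : Measure Ω) [IsProbabilityMeasure μ]
    (X Y : Ω → ℝ) (hmX : Measurable X) (hmY : Measurable Y)
    (hX0 : ∀ ω, 0 ≤ X ω) (hY0 : ∀ ω, 0 ≤ Y ω)
    (hind : IndepFun X Y μ)
    (hint : Integrable (fun ω => Real.log (1 + X ω)) μ) :
    (∫ ω, max (Real.log (1 + X ω) - Real.log (1 + Y ω)) 0 ∂μ) =
      (∫ x in Set.Ioi (0 : ℝ), (μ {ω | x < X ω}).toReal / (1 + x)) -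
        (∫ x in Set.Ioi (0 : ℝ),
          (μ {ω | x < X ω}).toReal * (μ {ω | x < Y ω}).toReal / (1 + x)) ∧
    (∫ ω, Real.log (1 + X ω) ∂μ) =
      ∫ x in Set.Ioi (0 : ℝ), (μ {ω | x < X ω}).toReal / (1 + x) := by
  refine ⟨?_, integral_log_one_add_eq_integral_meas_lt μ hmX hX0⟩
  have hmin0 : ∀ ω, 0 ≤ min (X ω) (Y ω) := fun ω => le_min (hX0 ω) (hY0 ω)
  have hmin : Measurable fun ω => min (X ω) (Y ω) := hmX.min hmY
  have htail : ∀ x : ℝ, (μ {ω | x < X ω}).toReal * (μ {ω | x < Y ω}).toReal =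
      (μ {ω | x < min (X ω) (Y ω)}).toReal := by
    intro x
    rw [← ENNReal.toReal_mul]
    simp only [lt_min_iff]
    exact congrArg ENNReal.toReal
      (hind.measure_inter_preimage_eq_mul _ _ measurableSet_Ioi measurableSet_Ioi).symm
  simp only [htail]
  rw [← integral_log_one_add_eq_integral_meas_lt μ hmX hX0,
    ← integral_log_one_add_eq_integral_meas_lt μ hmin hmin0, ← integral_sub hint]
  · refine integral_congr_ae (.of_forall fun ω => ?_)
    have hX := hX0 ω
    have hY := hY0 ω
    dsimp only
    rcases le_total (X ω) (Y ω) with h | h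
    · have := Real.log_le_log (by linarith) (add_le_add_right h 1)
      rw [min_eq_left h, sub_self, max_eq_right (by linarith)]
    · have := Real.log_le_log (by linarith) (add_le_add_right h 1)
      rw [min_eq_right h, max_eq_left (by linarith)]
  · refine hint.mono' (hmin.const_add 1).log.aestronglyMeasurable (.of_forall fun ω => ?_)
    have h := hmin0 ω
    rw [Real.norm_of_nonneg (Real.log_nonneg (by linarith))]
    exact Real.log_le_log (by linarith) (by linarith [min_le_left (X ω) (Y ω)])
end
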